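/- If G is a connected chordal graph that is not a clique and has no induced subgraph isomorphic to the claw K_{1,3}, then l(G), l*(G), a(G), and the number of pairwise inequivalent modified extreme points of G are all equal. -/

import Mathlib

open SimpleGraph

namespace Leafage

variable {V : Type*}

/-- A closed walk has a chord: an edge of the graph joining two vertices of the walk
that is not an edge of the walk. -/
def HasChord (G : SimpleGraph V) {v : V} (c : G.Walk v v) : Prop :=
  ∃ x y, x ∈ c.support ∧ y ∈ c.support ∧ G.Adj x y ∧ s(x, y) ∉ c.edges

/-- A graph is chordal if every cycle of length exceeding 3 has a chord. -/
def IsChordal (G : SimpleGraph V) : Prop :=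
  ∀ (v : V) (c : G.Walk v v), c.IsCycle → 3 < c.length → HasChord G c

/-- A leaf of a tree is a vertex of degree 1. -/
def IsLeaf (T : SimpleGraph V) (v : V) : Prop := (T.neighborSet v).ncard = 1

/-- The number of leaves of a tree. -/
noncomputable def numLeaves (T : SimpleGraph V) : ℕ := {v | IsLeaf T v}.ncard

/-- A subtree of a tree `T`, described by its vertex set: a set of vertices inducing a
(nonempty) connected subgraph. -/
def IsSubtree (T : SimpleGraph V) (S : Set V) : Prop := (T.induce S).Connected

/-- A subtree representation of `G` in a host tree `T`: each vertex `v` is assigned a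
subtree `f v` of `T`, and distinct vertices are adjacent iff their subtrees meet. -/
def IsSubtreeRep {α β : Type*} (G : SimpleGraph α) (T : SimpleGraph β) (f : α → Set β) : Prop :=
  (∀ v, IsSubtree T (f v)) ∧ ∀ u v, u ≠ v → (G.Adj u v ↔ (f u ∩ f v).Nonempty)

/-- A proper subtree representation: no subtree properly contains another. -/
def IsProperSubtreeRep {α β : Type*} (G : SimpleGraph α) (T : SimpleGraph β)
    (f : α → Set β) : Prop :=
  IsSubtreeRep G T f ∧ ∀ u v, u ≠ v → ¬ f u ⊂ f v

/-- The leafage of a graph: the minimum number of leaves of the host tree over all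
subtree representations. -/
noncomputable def leafage {α : Type*} (G : SimpleGraph α) : ℕ :=
  sInf {L | ∃ (m : ℕ) (T : SimpleGraph (Fin m)) (f : α → Set (Fin m)),
    T.IsTree ∧ IsSubtreeRep G T f ∧ numLeaves T = L}

/-- The proper leafage of a graph: the minimum number of leaves of the host tree over all
proper subtree representations. -/
noncomputable def properLeafage {α : Type*} (G : SimpleGraph α) : ℕ :=
  sInf {L | ∃ (m : ℕ) (T : SimpleGraph (Fin m)) (f : α → Set (Fin m)),
    T.IsTree ∧ IsProperSubtreeRep G T f ∧ numLeaves T = L}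

/-- `C` is between `A` and `B` (as subtrees of the tree `T`): `A` and `B` are disjoint and
the unique path of `T` connecting them meets `C` (equivalently, every walk from `A` to `B`
meets `C`). -/
def Between (T : SimpleGraph V) (A B C : Set V) : Prop :=
  Disjoint A B ∧ ∀ u v, u ∈ A → v ∈ B → ∀ p : T.Walk u v, ∃ x ∈ p.support, x ∈ C

/-- An asteroidal collection of subtrees: pairwise disjoint, and none between two others. -/
def AsteroidalCollection {ι : Type*} (T : SimpleGraph V) (Ts : ι → Set V) : Prop :=
  (∀ i j, i ≠ j → Disjoint (Ts i) (Ts j)) ∧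
    ∀ i j k, i ≠ j → j ≠ k → i ≠ k → ¬ Between T (Ts i) (Ts j) (Ts k)

/-- `x, y, z` form an asteroidal triple when each pair is joined by a path avoiding the
closed neighborhood of the third; by symmetry we record the path from `x` to `y`
avoiding `N[z]` and quantify over all orderings in `AsteroidalSet`. -/
def AsteroidalTriple (G : SimpleGraph V) (x y z : V) : Prop :=
  ∃ p : G.Walk x y, ∀ w ∈ p.support, w ≠ z ∧ ¬ G.Adj z w

/-- An asteroidal set: every triple of its vertices is an asteroidal triple. -/
def AsteroidalSet (G : SimpleGraph V) (A : Set V) : Prop :=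
  ∀ x ∈ A, ∀ y ∈ A, ∀ z ∈ A, x ≠ y → y ≠ z → x ≠ z → AsteroidalTriple G x y z

/-- `a(G)`: the maximum size of an asteroidal set in `G`. -/
noncomputable def astNum (G : SimpleGraph V) : ℕ :=
  sSup {n | ∃ A : Set V, AsteroidalSet G A ∧ A.ncard = n}

/-- A simplicial vertex: its neighborhood induces a clique. -/
def IsSimplicial (G : SimpleGraph V) (v : V) : Prop := G.IsClique (G.neighborSet v)

/-- The derived graph `G'`: the induced subgraph on the non-simplicial vertices. -/
def derivedGraph (G : SimpleGraph V) : SimpleGraph {v | ¬ IsSimplicial G v} :=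
  G.induce {v | ¬ IsSimplicial G v}

/-- A cutset: a set of vertices whose deletion leaves a disconnected subgraph. -/
def IsCutset {β : Type*} (H : SimpleGraph β) (S : Set β) : Prop :=
  (Sᶜ : Set β).Nonempty ∧ ¬ (H.induce Sᶜ).Preconnected

/-- A cut-vertex: some two other vertices are connected in `H` but not in `H - v`. -/
def IsCutVertex {β : Type*} (H : SimpleGraph β) (v : β) : Prop :=
  ∃ x y : ({v}ᶜ : Set β), H.Reachable ↑x ↑y ∧ ¬ (H.induce ({v}ᶜ : Set β)).Reachable x y

/-- A `k`-tree: there is a construction ordering of the vertices in which the first `k`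
vertices form a `k`-clique and each later vertex's neighborhood among earlier vertices is
a `k`-clique. -/
def IsKTree (k : ℕ) (G : SimpleGraph V) : Prop :=
  ∃ (n : ℕ) (e : Fin n ≃ V), k ≤ n ∧
    (∀ i j : Fin n, (i : ℕ) < k → (j : ℕ) < k → i ≠ j → G.Adj (e i) (e j)) ∧
    ∀ i : Fin n, k ≤ (i : ℕ) →
      G.IsClique {v | G.Adj (e i) v ∧ ∃ j, j < i ∧ e j = v} ∧
      {v | G.Adj (e i) v ∧ ∃ j, j < i ∧ e j = v}.ncard = k

/-- The collection of modified simplicial neighborhoods `N(v) - S(G)` for `v` simplicial;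
the poset `P(G)` is this collection ordered by inclusion. -/
def modNbhds (G : SimpleGraph V) : Set (Set V) :=
  {R | ∃ v, IsSimplicial G v ∧ R = G.neighborSet v \ {w | IsSimplicial G w}}

/-- The width of a family of sets under inclusion: the maximum size of an antichain. -/
noncomputable def familyWidth {β : Type*} (F : Set (Set β)) : ℕ :=
  sSup {n | ∃ A, A ⊆ F ∧ (∀ x ∈ A, ∀ y ∈ A, x ≠ y → ¬ x ⊆ y) ∧ A.ncard = n}

/-- The restricted simplicial neighborhood poset `P'(G)`: the modified simplicial
neighborhoods that do not contain a cutset of the derived graph `G'`. -/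
def restrictedModNbhds (G : SimpleGraph V) : Set (Set V) :=
  {R ∈ modNbhds G | ¬ ∃ C, C ⊆ R ∧ IsCutset (derivedGraph G) (Subtype.val ⁻¹' C)}

/-- The closed neighborhood `N[a]`. -/
def closedNbhd (G : SimpleGraph V) (a : V) : Set V := insert a (G.neighborSet a)

/-- Two vertices are equivalent if they have the same closed neighborhood. -/
def EquivVerts (G : SimpleGraph V) (u v : V) : Prop := closedNbhd G u = closedNbhd G v

/-- A graph is reduced if no two distinct vertices are equivalent. -/
def IsReduced (G : SimpleGraph V) : Prop := ∀ u v, EquivVerts G u v → u = v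

/-- The boundary `∂H` of a component `H` of `G - N[a]`: the vertices of `N[a]` having a
neighbor in `H`. -/
def compBoundary (G : SimpleGraph V) (a : V)
    (C : (G.induce (closedNbhd G a)ᶜ).ConnectedComponent) : Set V :=
  {x | x ∈ closedNbhd G a ∧ ∃ h : ((closedNbhd G a)ᶜ : Set V),
    (G.induce (closedNbhd G a)ᶜ).connectedComponentMk h = C ∧ G.Adj x ↑h}

/-- A modified extreme point (MEP): a simplicial vertex `a` such that all components of
`G - N[a]` have the same boundary. -/
def IsMEP (G : SimpleGraph V) (a : V) : Prop :=
  IsSimplicial G a ∧ ∀ C₁ C₂ : (G.induce (closedNbhd G a)ᶜ).ConnectedComponent,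
    compBoundary G a C₁ = compBoundary G a C₂

/-- An extreme point (EP): a simplicial vertex `a` such that every pair of distinct
vertices of `N(a)` not equivalent to `a` have a common neighbor outside `N[a]`. -/
def IsEP (G : SimpleGraph V) (a : V) : Prop :=
  IsSimplicial G a ∧ ∀ x ∈ G.neighborSet a, ∀ y ∈ G.neighborSet a, x ≠ y →
    ¬ EquivVerts G x a → ¬ EquivVerts G y a →
      ∃ z, z ∉ closedNbhd G a ∧ G.Adj x z ∧ G.Adj y z

/-- A block of `G`, as a vertex set: a maximal set inducing a connected subgraph
with no cut-vertex. -/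
def IsBlock (G : SimpleGraph V) (B : Set V) : Prop :=
  (G.induce B).Connected ∧ (∀ v : B, ¬ IsCutVertex (G.induce B) v) ∧
    ∀ B', B ⊆ B' → (G.induce B').Connected →
      (∀ v : B', ¬ IsCutVertex (G.induce B') v) → B' = B

/-- A block graph: every block is a clique. -/
def IsBlockGraph (G : SimpleGraph V) : Prop := ∀ B, IsBlock G B → G.IsClique B

/-- A leaf block: a block containing exactly one cut-vertex of `G`. -/
def IsLeafBlock (G : SimpleGraph V) (B : Set V) : Prop :=
  IsBlock G B ∧ {v | v ∈ B ∧ IsCutVertex G v}.ncard = 1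

/-- Claw-free: no induced subgraph isomorphic to `K_{1,3}`. -/
def ClawFree (G : SimpleGraph V) : Prop :=
  ¬ ∃ a b c d : V, b ≠ c ∧ b ≠ d ∧ c ≠ d ∧ G.Adj a b ∧ G.Adj a c ∧ G.Adj a d ∧
    ¬ G.Adj b c ∧ ¬ G.Adj b d ∧ ¬ G.Adj c d

/-- The set of the first `i+1` vertices in the ordering `e`. -/
def prefixSet {n : ℕ} (e : Fin n ≃ V) (i : Fin n) : Set V := {v | ∃ j, j ≤ i ∧ e j = v}

/-- A perfect elimination ordering, read in reverse (build order) as `e 0, e 1, …`: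
the neighborhood of each vertex among earlier vertices is a clique. -/
def IsPEO (G : SimpleGraph V) {n : ℕ} (e : Fin n ≃ V) : Prop :=
  ∀ i : Fin n, G.IsClique {v | G.Adj (e i) v ∧ ∃ j, j < i ∧ e j = v}

/-- `Q` is a maximal clique within the vertex set `W`. -/
def MaxCliqueIn (G : SimpleGraph V) (W Q : Set V) : Prop :=
  Q ⊆ W ∧ G.IsClique Q ∧ ∀ Q', Q' ⊆ W → G.IsClique Q' → Q ⊆ Q' → Q' = Q

/-- The creation time of a maximal clique `C` of `G` with respect to the build order `e`:
the first step at which the part of `C` built so far is a maximal clique of the graph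
built so far. -/
noncomputable def creationTime (G : SimpleGraph V) {n : ℕ} (e : Fin n ≃ V)
    (C : Set V) : ℕ :=
  sInf {t | ∃ i : Fin n, (i : ℕ) = t ∧ MaxCliqueIn G (prefixSet e i) (C ∩ prefixSet e i)}

/-- `Q` is the creation ordering of the maximal cliques of `G` with respect to the perfect
elimination ordering `e`: an enumeration of all maximal cliques of `G` listed in order of
creation. -/
def IsCreationOrdering (G : SimpleGraph V) {n : ℕ} (e : Fin n ≃ V) {m : ℕ}
    (Q : Fin m → Set V) : Prop :=
  Function.Injective Q ∧ (∀ i, MaxCliqueIn G Set.univ (Q i)) ∧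
    (∀ C, MaxCliqueIn G Set.univ C → ∃ i, Q i = C) ∧
    StrictMono fun i => creationTime G e (Q i)

/-- The width of the subposet of a poset on the set `S`: the maximum size of an
antichain contained in `S`. -/
noncomputable def widthIn {P : Type*} [PartialOrder P] (S : Set P) : ℕ :=
  sSup {n | ∃ A : Set P, A ⊆ S ∧ IsAntichain (· ≤ ·) A ∧ A.ncard = n}

end Leafage

open SimpleGraph Leafage

namespace Leafage

section Cuts

variable {β : Type*} {T : SimpleGraph β} {S A C : Set β}

/-- `S` is nonempty and no bipartition separates it without being crossed by an edge within `S`. -/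
def ConnOn (T : SimpleGraph β) (S : Set β) : Prop :=
  S.Nonempty ∧ ∀ (D : Set β) (a b : β), a ∈ S → b ∈ S → a ∈ D → b ∉ D →
    ∃ p ∈ S, ∃ q ∈ S, p ∈ D ∧ q ∉ D ∧ T.Adj p q

/-- Every edge is the only edge across some bipartition. -/
def CutAcyclic (T : SimpleGraph β) : Prop :=
  ∀ x y, T.Adj x y → ∃ D : Set β, x ∈ D ∧ y ∉ D ∧
    ∀ a ∈ D, ∀ b, b ∉ D → T.Adj a b → a = x ∧ b = y

theorem exists_crossing_edge {H : SimpleGraph β} {D : Set β} {x y : β} (p : H.Walk x y)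
    (hx : x ∈ D) (hy : y ∉ D) : ∃ a ∈ D, ∃ b, b ∉ D ∧ H.Adj a b := by
  induction p with
  | nil => exact absurd hx hy
  | @cons u v w h p ih =>
    by_cases hv : v ∈ D
    · exact ih hv hy
    · exact ⟨u, hx, v, hv, h⟩

theorem preconnected_of_cuts {H : SimpleGraph β}
    (h : ∀ (D : Set β) (a b : β), a ∈ D → b ∉ D → ∃ p ∈ D, ∃ q, q ∉ D ∧ H.Adj p q) :
    H.Preconnected := by
  intro x y
  by_contra hxy
  obtain ⟨p, hp, q, hq, hpq⟩ := h {z | H.Reachable x z} x y (Reachable.refl x) hxy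
  exact hq (hp.trans hpq.reachable)

theorem isSubtree_iff_connOn : IsSubtree T S ↔ ConnOn T S := by
  constructor
  · intro h
    obtain ⟨hpre, ⟨s⟩⟩ := (connected_iff _).1 h
    refine ⟨⟨s, s.2⟩, fun D a b ha hb haD hbD => ?_⟩
    obtain ⟨p⟩ := hpre ⟨a, ha⟩ ⟨b, hb⟩
    obtain ⟨p, hp, q, hq, hpq⟩ := exists_crossing_edge (D := Subtype.val ⁻¹' D) p haD hbD
    exact ⟨p, p.2, q, q.2, hp, hq, hpq⟩
  · rintro ⟨⟨s, hs⟩, h⟩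
    refine (connected_iff _).2 ⟨preconnected_of_cuts fun D a b ha hb => ?_, ⟨⟨s, hs⟩⟩⟩
    obtain ⟨p, hp, q, hq, hpD, hqD, hpq⟩ := h (Subtype.val '' D) a b a.2 b.2
      (Set.mem_image_of_mem _ ha) (by simpa using hb)
    refine ⟨⟨p, hp⟩, by simpa [hp] using hpD, ⟨q, hq⟩, by simpa [hq] using hqD, hpq⟩

theorem connected_iff_connOn_univ : T.Connected ↔ ConnOn T Set.univ := by
  rw [← isSubtree_iff_connOn]
  exact (induceUnivIso T).connected_iff.symm

theorem isTree_iff_cuts : T.IsTree ↔ ConnOn T Set.univ ∧ CutAcyclic T := by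
  rw [isTree_iff, connected_iff_connOn_univ, isAcyclic_iff_forall_adj_isBridge]
  refine and_congr_right fun _ => ⟨fun h x y hxy => ?_, fun h x y hxy => ?_⟩
  · have hb := isBridge_iff.1 (h hxy)
    refine ⟨{z | (T.deleteEdges {s(x, y)}).Reachable x z}, Reachable.refl x, hb,
      fun a ha b hab hadj => ?_⟩
    by_contra hne
    have : (T.deleteEdges {s(x, y)}).Adj a b := by
      refine (deleteEdges_adj).2 ⟨hadj, fun he => ?_⟩
      rcases Sym2.eq_iff.1 (Set.mem_singleton_iff.1 he) with he | ⟨rfl, rfl⟩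
      · exact hne he
      · exact hab (Reachable.refl _)
    exact hab (Reachable.trans ha this.reachable)
  · rw [isBridge_iff]
    rintro ⟨p⟩
    obtain ⟨D, hx, hy, hD⟩ := h x y hxy
    obtain ⟨a, ha, b, hb, hab⟩ := exists_crossing_edge p hx hy
    rw [deleteEdges_adj] at hab
    obtain ⟨rfl, rfl⟩ := hD a ha b hb hab.1
    exact hab.2 rfl

theorem connOn_singleton (a : β) : ConnOn T {a} :=
  ⟨⟨a, rfl⟩, fun D x y hx hy hxD hyD => by
    rw [Set.mem_singleton_iff] at hx hy; subst hx; subst hy; exact absurd hxD hyD⟩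

theorem ConnOn.union (hA : ConnOn T A) (hS : ConnOn T S) (h : (A ∩ S).Nonempty) :
    ConnOn T (A ∪ S) := by
  obtain ⟨c, hcA, hcS⟩ := h
  have key : ∀ X ⊆ A ∪ S, ConnOn T X → ∀ (D : Set β) (a b : β), a ∈ X → b ∈ X → a ∈ D → b ∉ D →
      ∃ p ∈ A ∪ S, ∃ q ∈ A ∪ S, p ∈ D ∧ q ∉ D ∧ T.Adj p q := by
    intro X hX hc D a b ha hb haD hbD
    obtain ⟨p, hp, q, hq, h⟩ := hc.2 D a b ha hb haD hbD
    exact ⟨p, hX hp, q, hX hq, h⟩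
  have kA := key A Set.subset_union_left hA
  have kS := key S Set.subset_union_right hS
  refine ⟨⟨c, Or.inl hcA⟩, fun D a b ha hb haD hbD => ?_⟩
  by_cases hc : c ∈ D
  · rcases hb with hb | hb
    · exact kA D c b hcA hb hc hbD
    · exact kS D c b hcS hb hc hbD
  · rcases ha with ha | ha
    · exact kA D a c ha hcA haD hc
    · exact kS D a c ha hcS haD hc

theorem connOn_pair {a b : β} (h : T.Adj a b) : ConnOn T {a, b} := by
  refine ⟨⟨a, by simp⟩, fun D x y hx hy hxD hyD => ?_⟩
  rcases hx with rfl | rfl <;> rcases hy with rfl | rfl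
  · exact absurd hxD hyD
  · exact ⟨x, by simp, y, by simp, hxD, hyD, h⟩
  · exact ⟨x, by simp, y, by simp, hxD, hyD, h.symm⟩
  · exact absurd hxD hyD

theorem ConnOn.insert {a b : β} (hS : ConnOn T S) (ha : a ∈ S) (h : T.Adj a b) :
    ConnOn T (Insert.insert b S) := by
  have := hS.union (connOn_pair h) ⟨a, ha, by simp⟩
  convert this using 1
  ext z
  simp only [Set.mem_insert_iff, Set.mem_union, Set.mem_singleton_iff]
  constructor
  · tauto
  · rintro (h | rfl | h)
    · exact Or.inr h
    · exact Or.inr ha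
    · exact Or.inl h

/-- `C` is a connected component of `T - S`, phrased through connected sets. -/
structure IsCompAvoiding (T : SimpleGraph β) (S C : Set β) : Prop where
  connOn : ConnOn T C
  disjoint : Disjoint C S
  subset_of_meets : ∀ A, ConnOn T A → Disjoint A S → (A ∩ C).Nonempty → A ⊆ C

theorem exists_isCompAvoiding [Finite β] (hA : ConnOn T A) (hAS : Disjoint A S) :
    ∃ C, A ⊆ C ∧ IsCompAvoiding T S C := by
  obtain ⟨C, hAC, hC⟩ := (Set.toFinite {C | ConnOn T C ∧ Disjoint C S}).exists_le_maximal
    (a := A) ⟨hA, hAS⟩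
  refine ⟨C, hAC, hC.prop.1, hC.prop.2, fun B hB hBS hBC => ?_⟩
  have := hC.le_of_ge (y := B ∪ C) ⟨hB.union hC.prop.1 hBC, hBS.union_left hC.prop.2⟩
    Set.subset_union_right
  exact Set.subset_union_left.trans this

theorem IsCompAvoiding.mem_of_adj (hC : IsCompAvoiding T S C) {a b : β} (ha : a ∈ C) (hb : b ∉ S)
    (h : T.Adj a b) : b ∈ C := by
  refine hC.subset_of_meets {a, b} (connOn_pair h) ?_ ⟨a, by simp, ha⟩ (by simp)
  rw [Set.disjoint_left]
  rintro x (rfl | rfl)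
  · exact Set.disjoint_left.1 hC.disjoint ha
  · exact hb

theorem IsCompAvoiding.connOn_compl (hC : IsCompAvoiding T S C) (hT : ConnOn T Set.univ)
    (hS : ConnOn T S) : ConnOn T Cᶜ := by
  have hSC : S ⊆ Cᶜ := fun x hx hxC => Set.disjoint_left.1 hC.disjoint hxC hx
  have key : ∀ (E : Set β) (b : β), S ⊆ E → b ∉ C → b ∉ E →
      ∃ p ∈ Cᶜ, ∃ q ∈ Cᶜ, p ∈ E ∧ q ∉ E ∧ T.Adj p q := by
    intro E b hSE hbC hbE
    obtain ⟨s, hs⟩ := hS.1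
    obtain ⟨p, -, q, -, hp, hq, hpq⟩ := hT.2 (Cᶜ \ E) b s trivial trivial ⟨hbC, hbE⟩
      (fun h => h.2 (hSE hs))
    have hqC : q ∉ C := fun hqC => hp.1 (hC.mem_of_adj hqC (fun h => hp.2 (hSE h)) hpq.symm)
    exact ⟨q, hqC, p, hp.1, by_contra fun h => hq ⟨hqC, h⟩, hp.2, hpq.symm⟩
  refine ⟨hS.1.mono hSC, fun D a b ha hb haD hbD => ?_⟩
  by_cases h1 : S ⊆ D
  · exact key D b h1 hb hbD
  by_cases h2 : S ⊆ Dᶜ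
  · obtain ⟨p, hp, q, hq, hpD, hqD, h⟩ := key Dᶜ a h2 ha (fun h => h haD)
    exact ⟨q, hq, p, hp, not_not.1 hqD, hpD, h.symm⟩
  obtain ⟨x, hx, hxD⟩ := Set.not_subset.1 h1
  obtain ⟨y, hy, hyD⟩ := Set.not_subset.1 h2
  obtain ⟨p, hp, q, hq, h⟩ := hS.2 D y x hy hx (not_not.1 hyD) hxD
  exact ⟨p, hSC hp, q, hSC hq, h⟩

theorem CutAcyclic.disjoint_of_adj (hT : CutAcyclic T) {q r : β} (hqr : T.Adj q r)
    (hS : ConnOn T S) (hA : ConnOn T A) (hqS : q ∈ S) (hrS : r ∉ S) (hrA : r ∈ A) (hqA : q ∉ A) :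
    Disjoint A S := by
  obtain ⟨D, hq, hr, hD⟩ := hT q r hqr
  rw [Set.disjoint_left]
  intro z hzA hzS
  by_cases hz : z ∈ D
  · obtain ⟨a, ha, b, hb, haD, hbD, hab⟩ := hA.2 D z r hzA hrA hz hr
    exact hqA ((hD a haD b hbD hab).1 ▸ ha)
  · obtain ⟨a, ha, b, hb, haD, hbD, hab⟩ := hS.2 D q z hqS hzS hq hz
    exact hrS ((hD a haD b hbD hab).2 ▸ hb)

theorem isLeaf_iff {t : β} : IsLeaf T t ↔ ∃ w, ∀ x, T.Adj t x ↔ x = w := by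
  simp [IsLeaf, Set.ncard_eq_one, Set.ext_iff]

theorem exists_leaf_notMem [Finite β] (hT : ConnOn T Set.univ) (hac : CutAcyclic T)
    (hC : ConnOn T C) (hne : C ≠ Set.univ) : ∃ t, IsLeaf T t ∧ t ∉ C := by
  obtain ⟨M, hCM, hM⟩ := (Set.toFinite {M | ConnOn T M ∧ M ≠ Set.univ}).exists_le_maximal
    (a := C) ⟨hC, hne⟩
  obtain ⟨⟨hMc, hMne⟩, -⟩ := id hM
  obtain ⟨c, hc⟩ := hMc.1
  obtain ⟨y, hy⟩ := (Set.ne_univ_iff_exists_notMem _).1 hMne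
  obtain ⟨p, -, t, -, hp, ht, hpt⟩ := hT.2 M c y trivial trivial hc hy
  have huniv : Insert.insert t M = Set.univ := by
    by_contra h
    exact ht (hM.le_of_ge (y := Insert.insert t M) ⟨hMc.insert hp hpt, h⟩ (Set.subset_insert _ _)
      (Set.mem_insert _ _))
  refine ⟨t, isLeaf_iff.2 ⟨p, fun x => ⟨fun hx => ?_, fun hx => hx ▸ hpt.symm⟩⟩, fun h => ht (hCM h)⟩
  by_contra hxp
  have hxM : x ∈ M := by
    have : x ∈ Insert.insert t M := huniv ▸ trivial
    exact this.resolve_left hx.ne'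
  have := hac.disjoint_of_adj hpt hMc (connOn_pair hx) hp ht (by simp)
    (by rintro (h | h); exacts [hpt.ne h, hxp h.symm])
  exact Set.disjoint_left.1 this (by simp) hxM

theorem two_le_numLeaves [Finite β] [Nontrivial β] (hT : ConnOn T Set.univ)
    (hac : CutAcyclic T) : 2 ≤ numLeaves T := by
  have hne : ∀ x : β, ({x} : Set β) ≠ Set.univ := fun x h => by
    obtain ⟨y, hy⟩ := exists_ne x
    exact hy (by simpa using (h ▸ trivial : y ∈ ({x} : Set β)))
  obtain ⟨x⟩ := (inferInstance : Nonempty β)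
  obtain ⟨s, hs, -⟩ := exists_leaf_notMem hT hac (connOn_singleton x) (hne x)
  obtain ⟨t, ht, hts⟩ := exists_leaf_notMem hT hac (connOn_singleton s) (hne s)
  calc 2 = ({s, t} : Set β).ncard := (Set.ncard_pair (fun h => hts h.symm)).symm
    _ ≤ _ := Set.ncard_le_ncard (by rintro z (rfl | rfl); exacts [hs, ht]) (Set.toFinite _)

end Cuts

section Asteroidal

variable {V : Type*} {G : SimpleGraph V} {β : Type*} {T : SimpleGraph β} {f : V → Set β}

theorem IsSubtreeRep.connOn (h : IsSubtreeRep G T f) (v : V) : ConnOn T (f v) :=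
  isSubtree_iff_connOn.1 (h.1 v)

theorem IsSubtreeRep.disjoint_iff (h : IsSubtreeRep G T f) {u v : V} (huv : u ≠ v) :
    Disjoint (f u) (f v) ↔ ¬ G.Adj u v := by
  rw [h.2 u v huv, Set.not_nonempty_iff_eq_empty, Set.disjoint_iff_inter_eq_empty]

theorem exists_not_adj_of_ne_top (h : G ≠ ⊤) : ∃ u v, u ≠ v ∧ ¬ G.Adj u v := by
  by_contra! hcon
  exact h (by ext u v; simpa using ⟨fun h => h.ne, hcon u v⟩)

theorem IsSubtreeRep.nontrivial (h : IsSubtreeRep G T f) (hG : G ≠ ⊤) : Nontrivial β := by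
  obtain ⟨u, v, huv, hadj⟩ := exists_not_adj_of_ne_top hG
  obtain ⟨a, ha⟩ := (h.connOn u).1
  obtain ⟨b, hb⟩ := (h.connOn v).1
  exact ⟨a, b, fun hab => Set.disjoint_left.1 ((h.disjoint_iff huv).2 hadj) ha (hab ▸ hb)⟩

theorem IsCompAvoiding.subset_of_walk (h : IsSubtreeRep G T f) {C : Set β} {x y z : V}
    (hC : IsCompAvoiding T (f z) C) (p : G.Walk x y)
    (hp : ∀ w ∈ p.support, w ≠ z ∧ ¬ G.Adj z w) (hx : f x ⊆ C) : f y ⊆ C := by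
  induction p with
  | nil => exact hx
  | @cons u v w huv p ih =>
    refine ih (fun w hw => hp w (by simp [hw])) ?_
    have hv := hp v (by simp)
    obtain ⟨t, ht, ht'⟩ := (h.2 u v huv.ne).1 huv
    exact hC.subset_of_meets _ (h.connOn v)
      ((h.disjoint_iff hv.1).2 fun h => hv.2 h.symm) ⟨t, ht', hx ht⟩

theorem ncard_le_numLeaves_of_asteroidalSet [Finite β] [Finite V] (hT : ConnOn T Set.univ)
    (hac : CutAcyclic T) (h : IsSubtreeRep G T f) (hG : G ≠ ⊤) {A : Set V}
    (hA : AsteroidalSet G A) : A.ncard ≤ numLeaves T := by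
  have := h.nontrivial hG
  by_cases hcard : A.ncard ≤ 2
  · exact hcard.trans (two_le_numLeaves hT hac)
  have third : ∀ x y, ∃ z ∈ A, z ≠ x ∧ z ≠ y := by
    intro x y
    by_contra! hcon
    have : A ⊆ {x, y} := fun z hz => by
      by_cases hzx : z = x
      · simp [hzx]
      · simp [hcon z hz hzx]
    exact hcard ((Set.ncard_le_ncard this (Set.toFinite _)).trans (Set.ncard_insert_le x {y} |>.trans
      (by simp)))
  have hdisj : ∀ x ∈ A, ∀ y ∈ A, x ≠ y → Disjoint (f x) (f y) := by
    intro x hx y hy hxy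
    obtain ⟨z, hz, hzx, hzy⟩ := third x y
    obtain ⟨p, hp⟩ := hA y hy z hz x hx hzy.symm hzx hxy.symm
    exact (h.disjoint_iff hxy).2 (hp y (by simp)).2
  have hcomp : ∀ x ∈ A, ∃ C, IsCompAvoiding T (f x) C ∧ ∀ y ∈ A, y ≠ x → f y ⊆ C := by
    intro x hx
    obtain ⟨y, hy, hyx, -⟩ := third x x
    obtain ⟨C, hyC, hC⟩ := exists_isCompAvoiding (h.connOn y) (hdisj y hy x hx hyx)
    refine ⟨C, hC, fun z hz hzx => ?_⟩
    by_cases hyz : y = z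
    · exact hyz ▸ hyC
    obtain ⟨p, hp⟩ := hA y hy z hz x hx hyz hzx hyx
    exact hC.subset_of_walk h p hp hyC
  choose! C hC hCsub using hcomp
  have hcover : ∀ x ∈ A, ∀ y ∈ A, x ≠ y → (C x)ᶜ ⊆ C y := by
    intro x hx y hy hxy
    obtain ⟨t, ht⟩ := (h.connOn x).1
    refine (hC y hy).subset_of_meets _ ((hC x hx).connOn_compl hT (h.connOn x)) ?_
      ⟨t, fun htC => Set.disjoint_left.1 (hC x hx).disjoint htC ht, hCsub y hy x hx hxy ht⟩
    rw [Set.disjoint_left]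
    exact fun s hs hsy => hs (hCsub x hx y hy hxy.symm hsy)
  have hleaf : ∀ x ∈ A, ∃ t, IsLeaf T t ∧ t ∉ C x := by
    intro x hx
    obtain ⟨t, ht⟩ := (h.connOn x).1
    exact exists_leaf_notMem hT hac (hC x hx).connOn fun huniv =>
      Set.disjoint_left.1 (hC x hx).disjoint (huniv ▸ trivial) ht
  choose! t ht htC using hleaf
  refine Set.ncard_le_ncard_of_injOn t ht (fun x hx y hy hxy => ?_) (Set.toFinite _)
  by_contra hne
  exact htC y hy (hxy ▸ hcover x hx y hy hne (htC x hx))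

end Asteroidal

section Simplicial

variable {V : Type*} {G : SimpleGraph V}

/-- Two nonadjacent neighbours of `v` cannot both attach to a connected set far from `v`. -/
theorem IsChordal.adj_of_attached (hG : IsChordal G) {H : Set V} (hH : ConnOn G H) {v x y : V}
    (hvx : G.Adj v x) (hvy : G.Adj v y) (hxy : x ≠ y) (hv : ∀ h ∈ H, h ≠ v ∧ ¬ G.Adj v h)
    (hx : ∃ h ∈ H, G.Adj x h) (hy : ∃ h ∈ H, G.Adj y h) : G.Adj x y := by
  by_contra hadj
  obtain ⟨a, ha, hxa⟩ := hx
  obtain ⟨b, hb, hyb⟩ := hy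
  have hK : IsSubtree G (insert x (insert y H)) :=
    isSubtree_iff_connOn.2 ((hH.insert hb hyb.symm).insert (Set.mem_insert_of_mem _ ha) hxa.symm)
  set K := insert x (insert y H) with hKdef
  have hxK : x ∈ K := by simp [K]
  have hyK : y ∈ K := by simp [K]
  have hvK : ∀ k ∈ K, k ≠ v ∧ (G.Adj v k → k = x ∨ k = y) := by
    rintro k (rfl | rfl | hk)
    · exact ⟨hvx.ne', fun _ => Or.inl rfl⟩
    · exact ⟨hvy.ne', fun _ => Or.inr rfl⟩
    · exact ⟨(hv k hk).1, fun h => absurd h (hv k hk).2⟩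
  obtain ⟨p, hp⟩ := Connected.exists_walk_length_eq_dist hK
    (⟨x, hxK⟩ : K) ⟨y, hyK⟩
  have hpath : p.IsPath := p.isPath_of_length_eq_dist hp
  let e : G.induce K ↪g G := Embedding.induce K
  let q : G.Walk x y := p.map e.toHom
  have hqlen : q.length = p.length := Walk.length_map _ _
  have hqpath : q.IsPath := hpath.map e.injective
  have hqK : ∀ w ∈ q.support, w ∈ K := by
    intro w hw
    have hw' : w ∈ p.support.map e.toHom := Walk.support_map e.toHom p ▸ hw
    obtain ⟨w', -, rfl⟩ := List.mem_map.1 hw'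
    exact w'.2
  have hvq : v ∉ q.support := fun h => (hvK v (hqK v h)).1 rfl
  have hlen : 2 ≤ q.length := by
    by_contra hlt
    have : q.length = 0 ∨ q.length = 1 := by omega
    rcases this with h | h
    · exact hxy (Walk.eq_of_length_eq_zero h)
    · exact hadj (Walk.adj_of_length_eq_one h)
  have hshort : ∀ i j, i < j → j ≤ q.length → G.Adj (q.getVert i) (q.getVert j) → j = i + 1 := by
    intro i j hij hj hadj'
    have hadj'' : (G.induce K).Adj (p.getVert i) (p.getVert j) := by
      have h' : G.Adj (e.toHom (p.getVert i)) (e.toHom (p.getVert j)) := by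
        rw [← Walk.getVert_map, ← Walk.getVert_map]
        exact hadj'
      exact h'
    have := dist_le ((p.take i).append (Walk.cons hadj'' (p.drop j)))
    simp only [Walk.length_append, Walk.length_cons, Walk.take_length, Walk.drop_length] at this
    omega
  let c : G.Walk v v := Walk.cons hvx (q.concat hvy.symm)
  have hcyc : c.IsCycle := by
    rw [Walk.cons_isCycle_iff]
    refine ⟨hqpath.concat hvq hvy.symm, ?_⟩
    rw [Walk.edges_concat, List.concat_eq_append, List.mem_append]
    rintro (h | h)
    · exact hvq (Walk.fst_mem_support_of_mem_edges _ h)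
    · simp only [List.mem_singleton, Sym2.eq_iff] at h
      rcases h with ⟨h, -⟩ | ⟨-, h⟩
      · exact hvy.ne h
      · exact hxy h
  have hclen : 3 < c.length := by
    simp only [c, Walk.length_cons, Walk.length_concat]; omega
  have hsupp : ∀ w, w ∈ c.support → w = v ∨ w ∈ q.support := by
    intro w hw
    simp only [c, Walk.support_cons, Walk.support_concat, List.mem_cons,
      List.mem_append, List.not_mem_nil, or_false] at hw
    tauto
  have hev : ∀ w ∈ q.support, G.Adj v w → s(v, w) ∈ c.edges := by
    intro w hw h
    rcases (hvK w (hqK w hw)).2 h with rfl | rfl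
    · simp [c]
    · simp [c, Walk.edges_concat, Sym2.eq_swap]
  have hord : ∀ i j, i < j → j ≤ q.length → G.Adj (q.getVert i) (q.getVert j) →
      s(q.getVert i, q.getVert j) ∈ c.edges := by
    intro i j hij hj h
    obtain rfl := hshort i j hij hj h
    have hi : i < q.length := hj
    have : s(q.getVert i, q.getVert (i + 1)) ∈ q.edges :=
      (Walk.mk_mem_edges_iff_exists q).2 ⟨i, hi, rfl⟩
    simp [c, Walk.edges_concat, this]
  obtain ⟨r, s, hr, hs, hrs, hne⟩ := hG v c hcyc hclen
  rcases hsupp r hr with hrv | hrq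
  · rcases hsupp s hs with hsv | hsq
    · exact hrs.ne (hrv.trans hsv.symm)
    · rw [hrv] at hrs hne
      exact hne (hev s hsq hrs)
  rcases hsupp s hs with hsv | hsq
  · rw [hsv] at hrs hne
    exact hne (Sym2.eq_swap ▸ hev r hrq hrs.symm)
  obtain ⟨i, rfl, hi⟩ := Walk.mem_support_iff_exists_getVert.1 hrq
  obtain ⟨j, rfl, hj⟩ := Walk.mem_support_iff_exists_getVert.1 hsq
  rcases lt_trichotomy i j with h | rfl | h
  · exact hne (hord i j h hj hrs)
  · exact hrs.ne rfl
  · exact hne (Sym2.eq_swap ▸ hord j i h hi hrs.symm)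

theorem IsChordal.exists_simplicial_far [Finite V] (hG : IsChordal G) :
    ∀ (n : ℕ) (W : Set V), W.ncard = n → ∀ v ∈ W, (∃ u ∈ W, u ≠ v ∧ ¬ G.Adj v u) →
      ∃ s ∈ W, s ≠ v ∧ ¬ G.Adj v s ∧ G.IsClique {x | x ∈ W ∧ G.Adj s x} := by
  intro n
  induction n using Nat.strong_induction_on with
  | _ n ih =>
  rintro W rfl v hvW ⟨u, huW, huv, hvu⟩
  let F : Set V := {x | x ∈ W ∧ x ≠ v ∧ ¬ G.Adj v x}
  have huF : u ∈ F := ⟨huW, huv, hvu⟩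
  obtain ⟨H, huH, hH⟩ := exists_isCompAvoiding (connOn_singleton (T := G) u) (S := Fᶜ)
    (by simpa using huF)
  have hHF : H ⊆ F := fun x hx => by
    by_contra hxF
    exact Set.disjoint_left.1 hH.disjoint hx hxF
  let S : Set V := {x | x ∈ W ∧ G.Adj v x ∧ ∃ h ∈ H, G.Adj x h}
  have hS : ∀ x ∈ S, ∀ y ∈ S, x ≠ y → G.Adj x y := fun x hx y hy hxy =>
    hG.adj_of_attached hH.connOn hx.2.1 hy.2.1 hxy (fun h hh => (hHF hh).2) hx.2.2 hy.2.2
  have hnbr : ∀ h ∈ H, ∀ x ∈ W, G.Adj h x → x ∈ H ∪ S := by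
    intro h hh x hxW hadj
    by_cases hvx : G.Adj v x
    · exact Or.inr ⟨hxW, hvx, h, hh, hadj.symm⟩
    · refine Or.inl (hH.mem_of_adj hh (b := x) (not_not.2 ⟨hxW, ?_, hvx⟩) hadj)
      rintro rfl
      exact (hHF hh).2.2 hadj.symm
  have hsub : H ∪ S ⊆ W := Set.union_subset (fun x hx => (hHF hx).1) fun x hx => hx.1
  have hvHS : v ∉ H ∪ S := by
    rintro (h | h)
    · exact (hHF h).2.1 rfl
    · exact h.2.1.ne rfl
  have hlt : (H ∪ S).ncard < W.ncard :=
    Set.ncard_lt_ncard ⟨hsub, fun h => hvHS (h hvW)⟩ (Set.toFinite _)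
  suffices hsuff : ∃ s ∈ H, G.IsClique {x | x ∈ H ∪ S ∧ G.Adj s x} by
    obtain ⟨s, hs, hcl⟩ := hsuff
    refine ⟨s, (hHF hs).1, (hHF hs).2.1, (hHF hs).2.2, hcl.subset ?_⟩
    exact fun x hx => ⟨hnbr s hs x hx.1 hx.2, hx.2⟩
  by_cases h1 : ∃ s ∈ S, ∃ h ∈ H, ¬ G.Adj s h
  · obtain ⟨s, hs, h, hh, hsh⟩ := h1
    obtain ⟨t, ht, hts, hst, hcl⟩ := ih _ hlt (H ∪ S) rfl s (Or.inr hs)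
      ⟨h, Or.inl hh, fun he => (hHF hh).2.2 (he ▸ hs.2.1), hsh⟩
    exact ⟨t, ht.resolve_right fun h => hst (hS s hs t h hts.symm), hcl⟩
  push Not at h1
  obtain ⟨t, ht, hcl⟩ : ∃ t ∈ H, G.IsClique {x | x ∈ H ∧ G.Adj t x} := by
    by_cases h2 : G.IsClique H
    · exact ⟨u, huH rfl, h2.subset fun x hx => hx.1⟩
    · simp only [IsClique, Set.Pairwise] at h2
      push Not at h2
      obtain ⟨a, ha, b, hb, hab, hadj⟩ := h2
      obtain ⟨t, ht, -, -, hcl⟩ := ih _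
        ((Set.ncard_le_ncard Set.subset_union_left (Set.toFinite _)).trans_lt hlt) H rfl a ha
        ⟨b, hb, hab.symm, hadj⟩
      exact ⟨t, ht, hcl⟩
  refine ⟨t, ht, ?_⟩
  rintro x ⟨hx | hx, hxt⟩ y ⟨hy | hy, hyt⟩ hxy
  · exact hcl ⟨hx, hxt⟩ ⟨hy, hyt⟩ hxy
  · exact (h1 y hy x hx).symm
  · exact h1 x hx y hy
  · exact hS x hx y hy hxy

theorem IsChordal.exists_simplicial [Finite V] (hG : IsChordal G) {W : Set V}
    (hW : W.Nonempty) : ∃ s ∈ W, G.IsClique {x | x ∈ W ∧ G.Adj s x} := by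
  by_cases h : G.IsClique W
  · obtain ⟨s, hs⟩ := hW
    exact ⟨s, hs, h.subset fun x hx => hx.1⟩
  · simp only [IsClique, Set.Pairwise] at h
    push Not at h
    obtain ⟨a, ha, b, hb, hab, hadj⟩ := h
    obtain ⟨s, hs, -, -, hcl⟩ := hG.exists_simplicial_far _ W rfl a ha ⟨b, hb, hab.symm, hadj⟩
    exact ⟨s, hs, hcl⟩

end Simplicial

section TreeExtension

variable {β : Type*} {T : SimpleGraph β} {S : Set β} {P : Prop}

/-- Extend a set of vertices to `Option β`, containing the new vertex `none` iff `P` holds. -/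
def optionExtend (S : Set β) (P : Prop) : Set (Option β) := {x | x.elim P (· ∈ S)}

@[simp] theorem some_mem_optionExtend {x : β} : some x ∈ optionExtend S P ↔ x ∈ S := Iff.rfl

@[simp] theorem none_mem_optionExtend : none ∈ optionExtend S P ↔ P := Iff.rfl

theorem optionExtend_univ_true : optionExtend (Set.univ : Set β) True = Set.univ := by
  ext (_ | x) <;> simp

theorem optionExtend_subset_iff {S' : Set β} {P' : Prop} :
    optionExtend S P ⊆ optionExtend S' P' ↔ S ⊆ S' ∧ (P → P') := by
  constructor
  · exact fun h => ⟨fun x hx => h (a := some x) hx, fun hP => h (a := none) hP⟩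
  · rintro ⟨h, hP⟩ (_ | x) hx
    exacts [hP hx, h hx]

theorem optionExtend_inter_nonempty_iff {S' : Set β} {P' : Prop} :
    (optionExtend S P ∩ optionExtend S' P').Nonempty ↔ (S ∩ S').Nonempty ∨ (P ∧ P') := by
  constructor
  · rintro ⟨_ | x, hx, hx'⟩
    exacts [Or.inr ⟨hx, hx'⟩, Or.inl ⟨x, hx, hx'⟩]
  · rintro (⟨x, hx, hx'⟩ | h)
    exacts [⟨some x, hx, hx'⟩, ⟨none, h.1, h.2⟩]

theorem connOn_optionExtend {T' : SimpleGraph (Option β)} (hS : ConnOn T S)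
    (hadj : ∀ x ∈ S, ∀ y ∈ S, T.Adj x y → T'.Adj (some x) (some y) ∨
      (P ∧ T'.Adj (some x) none ∧ T'.Adj none (some y)))
    (hP : P → ∃ x ∈ S, T'.Adj (some x) none) : ConnOn T' (optionExtend S P) := by
  obtain ⟨s, hs⟩ := hS.1
  refine ⟨⟨some s, hs⟩, fun D a b ha hb haD hbD => ?_⟩
  by_cases hsplit : (∃ x ∈ S, some x ∈ D) ∧ ∃ y ∈ S, some y ∉ D
  · obtain ⟨⟨x, hx, hxD⟩, y, hy, hyD⟩ := hsplit
    obtain ⟨p, hp, q, hq, hpD, hqD, hpq⟩ := hS.2 (some ⁻¹' D) x y hx hy hxD hyD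
    rcases hadj p hp q hq hpq with h | ⟨hP', hpn, hnq⟩
    · exact ⟨some p, hp, some q, hq, hpD, hqD, h⟩
    · by_cases hn : none ∈ D
      · exact ⟨none, hP', some q, hq, hn, hqD, hnq⟩
      · exact ⟨some p, hp, none, hP', hpD, hn, hpn⟩
  · rcases a with _ | a <;> rcases b with _ | b
    · exact absurd haD hbD
    · obtain ⟨x, hx, h⟩ := hP ha
      have hxD : some x ∉ D := fun hxD => hsplit ⟨⟨x, hx, hxD⟩, b, hb, hbD⟩
      exact ⟨none, ha, some x, hx, haD, hxD, h.symm⟩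
    · obtain ⟨x, hx, h⟩ := hP hb
      have hxD : some x ∈ D := by_contra fun hxD => hsplit ⟨⟨a, ha, haD⟩, x, hx, hxD⟩
      exact ⟨some x, hx, none, hb, hxD, hbD, h⟩
    · exact absurd ⟨⟨a, ha, haD⟩, b, hb, hbD⟩ hsplit

/-- Attach a new vertex `none` to the vertex `b`. -/
def attach (T : SimpleGraph β) (b : β) : SimpleGraph (Option β) where
  Adj
    | some x, some y => T.Adj x y
    | some x, none => x = b
    | none, some y => y = b
    | none, none => False
  symm := ⟨by rintro (_ | x) (_ | y) h; exacts [h, h, h, SimpleGraph.Adj.symm h]⟩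
  loopless := ⟨by rintro (_ | x) h; exacts [h, T.loopless.irrefl x h]⟩

/-- Subdivide the edge between `q` and `r` by a new vertex `none`. -/
def subdivide (T : SimpleGraph β) (q r : β) : SimpleGraph (Option β) where
  Adj
    | some x, some y => T.Adj x y ∧ ¬ (x = q ∧ y = r) ∧ ¬ (x = r ∧ y = q)
    | some x, none => x = q ∨ x = r
    | none, some y => y = q ∨ y = r
    | none, none => False
  symm := ⟨by
    rintro (_ | x) (_ | y) h
    exacts [h, h, h, ⟨h.1.symm, fun h' => h.2.2 h'.symm, fun h' => h.2.1 h'.symm⟩]⟩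
  loopless := ⟨by rintro (_ | x) h; exacts [h, T.loopless.irrefl x h.1]⟩

@[simp] theorem attach_some_some {b x y : β} : (attach T b).Adj (some x) (some y) ↔ T.Adj x y :=
  Iff.rfl
@[simp] theorem attach_some_none {b x : β} : (attach T b).Adj (some x) none ↔ x = b := Iff.rfl
@[simp] theorem attach_none_some {b x : β} : (attach T b).Adj none (some x) ↔ x = b := Iff.rfl
@[simp] theorem subdivide_some_some {q r x y : β} : (subdivide T q r).Adj (some x) (some y) ↔
    T.Adj x y ∧ ¬ (x = q ∧ y = r) ∧ ¬ (x = r ∧ y = q) := Iff.rfl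
@[simp] theorem subdivide_some_none {q r x : β} :
    (subdivide T q r).Adj (some x) none ↔ x = q ∨ x = r := Iff.rfl
@[simp] theorem subdivide_none_some {q r x : β} :
    (subdivide T q r).Adj none (some x) ↔ x = q ∨ x = r := Iff.rfl

theorem ConnOn.attach {b : β} (hS : ConnOn T S) (hP : P → b ∈ S) :
    ConnOn (attach T b) (optionExtend S P) :=
  connOn_optionExtend hS (fun _ _ _ _ h => Or.inl h) fun h => ⟨b, hP h, rfl⟩

theorem ConnOn.subdivide {q r : β} (hS : ConnOn T S) (hP : P → q ∈ S) (hqr : q ∈ S → r ∈ S → P) :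
    ConnOn (subdivide T q r) (optionExtend S P) := by
  refine connOn_optionExtend hS (fun x hx y hy h => ?_) fun h => ⟨q, hP h, Or.inl rfl⟩
  by_cases h1 : x = q ∧ y = r
  · obtain ⟨rfl, rfl⟩ := h1
    exact Or.inr ⟨hqr hx hy, Or.inl rfl, Or.inr rfl⟩
  by_cases h2 : x = r ∧ y = q
  · obtain ⟨rfl, rfl⟩ := h2
    exact Or.inr ⟨hqr hy hx, Or.inr rfl, Or.inl rfl⟩
  exact Or.inl ⟨h, h1, h2⟩

theorem ConnOn.attach_univ {b : β} (hT : ConnOn T Set.univ) :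
    ConnOn (Leafage.attach T b) Set.univ :=
  optionExtend_univ_true ▸ hT.attach fun _ => trivial

theorem ConnOn.subdivide_univ {q r : β} (hT : ConnOn T Set.univ) :
    ConnOn (Leafage.subdivide T q r) Set.univ :=
  optionExtend_univ_true ▸ hT.subdivide (fun _ => trivial) fun _ _ => trivial

theorem CutAcyclic.attach {b : β} (hT : CutAcyclic T) : CutAcyclic (attach T b) := by
  rintro (_ | x) (_ | y) h
  · exact h.elim
  · refine ⟨{none}, rfl, by simp, ?_⟩
    rintro a rfl (_ | b') hb hab
    · exact hab.elim
    · exact ⟨rfl, congrArg some (hab.trans (Eq.symm h))⟩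
  · refine ⟨{none}ᶜ, by simp, by simp, ?_⟩
    rintro (_ | a) ha b' hb hab
    · exact absurd rfl ha
    · obtain rfl : b' = none := by simpa using hb
      exact ⟨congrArg some (hab.trans (Eq.symm h)), rfl⟩
  · obtain ⟨D, hx, hy, hD⟩ := hT x y h
    refine ⟨optionExtend D (b ∈ D), hx, hy, ?_⟩
    rintro (_ | a) ha (_ | c) hc hac
    · exact hac.elim
    · obtain rfl : c = b := hac
      exact absurd ha hc
    · obtain rfl : a = b := hac
      exact absurd ha hc
    · simpa using hD a ha c hc hac

theorem CutAcyclic.subdivide {q r : β} (hT : CutAcyclic T) (hqr : T.Adj q r) :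
    CutAcyclic (subdivide T q r) := by
  have hcut : ∀ P : Prop, ∃ D : Set β, q ∈ D ∧ r ∉ D ∧
      ∀ a ∈ optionExtend D P, ∀ b, b ∉ optionExtend D P → (Leafage.subdivide T q r).Adj a b →
        (P ∧ a = none ∧ b = some r) ∨ (¬ P ∧ a = some q ∧ b = none) := by
    intro P
    obtain ⟨D, hq, hr, hD⟩ := hT q r hqr
    refine ⟨D, hq, hr, ?_⟩
    rintro (_ | a) ha (_ | b) hb hab
    · exact hab.elim
    · rcases hab with rfl | rfl
      · exact absurd hq hb
      · exact Or.inl ⟨ha, rfl, rfl⟩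
    · rcases hab with rfl | rfl
      · exact Or.inr ⟨hb, rfl, rfl⟩
      · exact absurd ha hr
    · exact absurd (hD a ha b hb hab.1) hab.2.1
  have hsymm : ∀ a b, (∃ D : Set (Option β), a ∈ D ∧ b ∉ D ∧ ∀ x ∈ D, ∀ y, y ∉ D →
      (Leafage.subdivide T q r).Adj x y → x = a ∧ y = b) → ∃ D : Set (Option β), b ∈ D ∧ a ∉ D ∧
        ∀ x ∈ D, ∀ y, y ∉ D → (Leafage.subdivide T q r).Adj x y → x = b ∧ y = a := by
    rintro a b ⟨D, ha, hb, hD⟩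
    exact ⟨Dᶜ, hb, not_not.2 ha, fun x hx y hy h => (hD y (not_not.1 hy) x hx h.symm).symm⟩
  have hnr : ∃ D : Set (Option β), none ∈ D ∧ some r ∉ D ∧ ∀ x ∈ D, ∀ y, y ∉ D →
      (Leafage.subdivide T q r).Adj x y → x = none ∧ y = some r := by
    obtain ⟨D, hq, hr, hD⟩ := hcut True
    exact ⟨optionExtend D True, trivial, hr, fun x hx y hy h => by simpa using hD x hx y hy h⟩
  have hqn : ∃ D : Set (Option β), some q ∈ D ∧ none ∉ D ∧ ∀ x ∈ D, ∀ y, y ∉ D →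
      (Leafage.subdivide T q r).Adj x y → x = some q ∧ y = none := by
    obtain ⟨D, hq, hr, hD⟩ := hcut False
    exact ⟨optionExtend D False, hq, fun h => h, fun x hx y hy h => by simpa using hD x hx y hy h⟩
  rintro (_ | x) (_ | y) h
  · exact h.elim
  · rcases h with rfl | rfl
    exacts [hsymm _ _ hqn, hnr]
  · rcases h with rfl | rfl
    exacts [hqn, hsymm _ _ hnr]
  · obtain ⟨hxy, h1, h2⟩ := h
    obtain ⟨D, hx, hy, hD⟩ := hT x y hxy
    have hqr' : q ∈ D ↔ r ∈ D := by
      constructor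
      · intro hq
        by_contra hr
        obtain ⟨rfl, rfl⟩ := hD q hq r hr hqr
        exact h1 ⟨rfl, rfl⟩
      · intro hr
        by_contra hq
        obtain ⟨rfl, rfl⟩ := hD r hr q hq hqr.symm
        exact h2 ⟨rfl, rfl⟩
    refine ⟨optionExtend D (q ∈ D), hx, hy, ?_⟩
    rintro (_ | a) ha (_ | c) hc hac
    · exact hac.elim
    · rcases hac with rfl | rfl
      exacts [absurd ha hc, absurd (hqr'.1 ha) hc]
    · rcases hac with rfl | rfl
      exacts [absurd ha hc, absurd (hqr'.2 ha) hc]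
    · simpa using hD a ha c hc hac.1

theorem isLeaf_attach_some_iff {b x : β} (hx : x ≠ b) :
    IsLeaf (attach T b) (some x) ↔ IsLeaf T x := by
  simp only [isLeaf_iff]
  constructor
  · rintro ⟨_ | w, hw⟩
    · exact absurd ((hw none).2 rfl) hx
    · exact ⟨w, fun y => by simpa using hw (some y)⟩
  · rintro ⟨w, hw⟩
    refine ⟨some w, ?_⟩
    rintro (_ | y)
    · simpa using hx
    · simpa using hw y

theorem not_isLeaf_attach_of_isLeaf {b : β} (hb : IsLeaf T b) : ¬ IsLeaf (attach T b) (some b) := by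
  obtain ⟨w, hw⟩ := isLeaf_iff.1 hb
  rw [isLeaf_iff]
  rintro ⟨c, hc⟩
  have h1 := (hc none).1 rfl
  have h2 := (hc (some w)).1 ((hw w).2 rfl)
  exact Option.some_ne_none w (h2.trans h1.symm)

theorem isLeaf_subdivide_some_iff {q r x : β} (hqr : T.Adj q r) :
    IsLeaf (subdivide T q r) (some x) ↔ IsLeaf T x := by
  have key : ∀ w y : β, T.Adj x w → (¬ ∃ z, T.Adj x z ∧ z ≠ w) → (T.Adj x y ↔ y = w) :=
    fun w y hw h => ⟨fun hy => by_contra fun hne => h ⟨y, hy, hne⟩, fun hy => hy ▸ hw⟩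
  simp only [isLeaf_iff]
  by_cases hx : x = q ∨ x = r
  · obtain ⟨z, hz, hzx⟩ : ∃ z, T.Adj x z ∧ ∀ y, (Leafage.subdivide T q r).Adj (some x) (some y) ↔
        T.Adj x y ∧ y ≠ z := by
      rcases hx with rfl | rfl
      · refine ⟨r, hqr, fun y => ?_⟩
        have := hqr.ne
        simp only [subdivide_some_some]
        grind
      · refine ⟨q, hqr.symm, fun y => ?_⟩
        have := hqr.ne
        simp only [subdivide_some_some]
        grind
    constructor
    · rintro ⟨w, hw⟩
      obtain rfl : none = w := (hw none).1 hx
      refine ⟨z, fun y => key z y hz ?_⟩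
      rintro ⟨y, hy, hyz⟩
      exact Option.some_ne_none y ((hw (some y)).1 ((hzx y).2 ⟨hy, hyz⟩))
    · rintro ⟨w, hw⟩
      refine ⟨none, ?_⟩
      rintro (_ | y)
      · simpa using hx
      · rw [hzx, hw y]
        obtain rfl := (hw z).1 hz
        simp
  · push Not at hx
    constructor
    · rintro ⟨_ | w, hw⟩
      · exact absurd ((hw none).2 rfl) (by simpa using hx)
      · exact ⟨w, fun y => by simpa [hx] using hw (some y)⟩
    · rintro ⟨w, hw⟩
      refine ⟨some w, ?_⟩
      rintro (_ | y)
      · simpa using hx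
      · simpa [hx] using hw y

theorem not_isLeaf_subdivide_none {q r : β} (hqr : q ≠ r) : ¬ IsLeaf (subdivide T q r) none := by
  rw [isLeaf_iff]
  rintro ⟨c, hc⟩
  have h1 := (hc (some q)).1 (Or.inl rfl)
  have h2 := (hc (some r)).1 (Or.inr rfl)
  exact hqr (Option.some_injective _ (h1.trans h2.symm))

theorem numLeaves_attach_le [Finite β] {b : β} (hb : IsLeaf T b) :
    numLeaves (attach T b) ≤ numLeaves T := by
  have hsome : ∀ x, IsLeaf (attach T b) (some x) → x ≠ b := by
    rintro x hx rfl
    exact not_isLeaf_attach_of_isLeaf hb hx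
  refine Set.ncard_le_ncard_of_injOn (fun x : Option β => x.getD b) ?_ ?_ (Set.toFinite _)
  · rintro (_ | x) hx
    · exact hb
    · exact (isLeaf_attach_some_iff (hsome x hx)).1 hx
  · rintro (_ | x) hx (_ | y) hy hxy
    · rfl
    · exact absurd (Eq.symm hxy) (hsome y hy)
    · exact absurd hxy (hsome x hx)
    · exact congrArg some hxy

theorem numLeaves_subdivide_le [Finite β] {q r : β} (hqr : T.Adj q r) :
    numLeaves (subdivide T q r) ≤ numLeaves T := by
  refine Set.ncard_le_ncard_of_injOn (fun x : Option β => x.getD q) ?_ ?_ (Set.toFinite _)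
  · rintro (_ | x) hx
    · exact absurd hx (not_isLeaf_subdivide_none hqr.ne)
    · exact (isLeaf_subdivide_some_iff hqr).1 hx
  · rintro (_ | x) hx (_ | y) hy hxy
    · rfl
    · exact absurd hx (not_isLeaf_subdivide_none hqr.ne)
    · exact absurd hy (not_isLeaf_subdivide_none hqr.ne)
    · exact congrArg some hxy

end TreeExtension

section CliqueTree

variable {V : Type*} {G : SimpleGraph V} {β : Type*} {T : SimpleGraph β}

/-- `T` with bags `B` is a clique tree of `G` on `W`: bags at adjacent nodes are incomparable. -/
structure IsCliqueTree (G : SimpleGraph V) (W : Set V) (T : SimpleGraph β) (B : β → Set V) :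
    Prop where
  connOn_univ : ConnOn T Set.univ
  cutAcyclic : CutAcyclic T
  subset : ∀ b, B b ⊆ W
  isClique : ∀ b, G.IsClique (B b)
  exists_bag : ∀ K ⊆ W, G.IsClique K → ∃ b, K ⊆ B b
  connOn : ∀ v ∈ W, ConnOn T {b | v ∈ B b}
  not_subset : ∀ a b, T.Adj a b → ¬ B a ⊆ B b

theorem IsChordal.exists_isCliqueTree [Finite V] (hG : IsChordal G) :
    ∀ (n : ℕ) (W : Set V), W.ncard = n →
      ∃ (β : Type) (_ : Finite β) (T : SimpleGraph β) (B : β → Set V), IsCliqueTree G W T B := by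
  intro n
  induction n with
  | zero =>
    intro W hW
    obtain rfl : W = ∅ := (Set.ncard_eq_zero (Set.toFinite _)).1 hW
    exact ⟨Unit, inferInstance, ⊥, fun _ => ∅,
      { connOn_univ := by
          convert connOn_singleton (T := (⊥ : SimpleGraph Unit)) () using 1
          ext; simp
        cutAcyclic := fun _ _ h => h.elim
        subset := fun _ => le_rfl
        isClique := fun _ => by simp
        exists_bag := fun K hK _ => ⟨(), hK⟩
        connOn := fun v hv => hv.elim
        not_subset := fun _ _ h => h.elim }⟩
  | succ n ih =>
    intro W hW
    have hne : W.Nonempty := by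
      rw [← Set.ncard_pos (Set.toFinite _)]
      omega
    obtain ⟨s, hsW, hs⟩ := hG.exists_simplicial hne
    classical
    obtain ⟨β, hβ, T, B, hT⟩ := ih (W \ {s})
      (by rw [Set.ncard_sdiff_singleton_of_mem hsW, hW]; rfl)
    set K : Set V := {x | x ∈ W ∧ G.Adj s x} with hK
    have hsK : s ∉ K := fun h => G.loopless.irrefl s h.2
    have hKW : K ⊆ W \ {s} := fun x hx => ⟨hx.1, hx.2.ne'⟩
    have hsB : ∀ b, s ∉ B b := fun b h => (hT.subset b h).2 rfl
    have hsKcl : G.IsClique (insert s K) := hs.insert fun x hx _ => hx.2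
    have hsub : ∀ L ⊆ W, G.IsClique L → s ∈ L → L ⊆ insert s K := by
      intro L hL hcl hsL x hx
      by_cases hxs : x = s
      · exact Or.inl hxs
      · exact Or.inr ⟨hL hx, hcl hsL hx (Ne.symm hxs)⟩
    obtain ⟨b, hb⟩ := hT.exists_bag K hKW hs
    by_cases hbK : B b ⊆ K
    · obtain hBb : B b = K := hbK.antisymm hb
      have hmem : ∀ v, v ≠ s → ∀ c, v ∈ Function.update B b (insert s K) c ↔ v ∈ B c := by
        intro v hv c
        by_cases hcb : c = b
        · subst hcb; simp [hv, hBb]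
        · simp [hcb]
      have hmems : ∀ c, s ∈ Function.update B b (insert s K) c ↔ c = b := by
        intro c
        by_cases hcb : c = b
        · subst hcb; simp
        · simp [hcb, hsB]
      refine ⟨β, hβ, T, Function.update B b (insert s K), ⟨hT.connOn_univ, hT.cutAcyclic,
        fun c => ?_, fun c => ?_, fun L hL hcl => ?_, fun v hv => ?_, fun c d hcd hsub' => ?_⟩⟩
      · by_cases hcb : c = b
        · subst hcb
          simpa using Set.insert_subset hsW fun x hx => hx.1
        · simpa [hcb] using (hT.subset c).trans Set.sdiff_subset
      · by_cases hcb : c = b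
        · subst hcb; simpa using hsKcl
        · simpa [hcb] using hT.isClique c
      · by_cases hsL : s ∈ L
        · exact ⟨b, by simpa using hsub L hL hcl hsL⟩
        · obtain ⟨c, hc⟩ := hT.exists_bag L (fun x hx => ⟨hL hx, fun h => hsL (h ▸ hx)⟩) hcl
          exact ⟨c, fun x hx => (hmem x (fun h => hsL (h ▸ hx)) c).2 (hc hx)⟩
      · by_cases hvs : v = s
        · subst hvs
          simp only [hmems]
          exact connOn_singleton b
        · simp only [hmem v hvs]
          exact hT.connOn v ⟨hv, hvs⟩
      · refine hT.not_subset c d hcd fun x hx => ?_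
        have hxs : x ≠ s := fun h => hsB c (h ▸ hx)
        exact (hmem x hxs d).1 (hsub' ((hmem x hxs c).2 hx))
    · refine ⟨Option β, inferInstance, attach T b, fun c => c.elim (insert s K) B,
        ⟨hT.connOn_univ.attach_univ, hT.cutAcyclic.attach, ?_, ?_, fun L hL hcl => ?_,
          fun v hv => ?_, ?_⟩⟩
      · rintro (_ | c)
        · exact Set.insert_subset hsW fun x hx => hx.1
        · exact (hT.subset c).trans Set.sdiff_subset
      · rintro (_ | c)
        exacts [hsKcl, hT.isClique c]
      · by_cases hsL : s ∈ L
        · exact ⟨none, hsub L hL hcl hsL⟩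
        · obtain ⟨c, hc⟩ := hT.exists_bag L (fun x hx => ⟨hL hx, fun h => hsL (h ▸ hx)⟩) hcl
          exact ⟨some c, hc⟩
      · by_cases hvs : v = s
        · subst hvs
          convert connOn_singleton (T := attach T b) none using 1
          ext (_ | c)
          · simp
          · simpa using hsB c
        · convert (hT.connOn v ⟨hv, hvs⟩).attach (b := b) (P := v ∈ K) (fun h => hb h) using 1
          ext (_ | c)
          · simp [hvs]
          · simp
      · rintro (_ | c) (_ | d) h hsub'
        · exact h
        · exact hsB d (hsub' (Set.mem_insert s K))
        · obtain rfl : c = b := h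
          refine hbK fun x hx => (hsub' hx).resolve_left fun h => hsB c (h ▸ hx)
        · exact hT.not_subset c d h hsub'

variable {B : β → Set V}

theorem IsCliqueTree.isSubtreeRep (hT : IsCliqueTree G Set.univ T B) :
    IsSubtreeRep G T fun v => {b | v ∈ B b} := by
  refine ⟨fun v => isSubtree_iff_connOn.2 (hT.connOn v trivial), fun u v huv => ⟨fun h => ?_, ?_⟩⟩
  · obtain ⟨b, hb⟩ := hT.exists_bag {u, v} (Set.subset_univ _) (by simpa [huv] using h)
    exact ⟨b, hb (by simp), hb (by simp)⟩
  · rintro ⟨b, hu, hv⟩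
    exact hT.isClique b hu hv huv

/-- Whenever `f u` is properly contained in `f v`, either some edge of the tree leaves both
subtrees from within `f u`, or `f u` contains a leaf of the tree. -/
def Extendable (T : SimpleGraph β) (f : V → Set β) : Prop :=
  ∀ u v, f u ⊂ f v → (∃ q r, T.Adj q r ∧ q ∈ f u ∧ r ∉ f v) ∨ ∃ t, IsLeaf T t ∧ t ∈ f u

theorem IsCliqueTree.extendable [Finite β] (hT : IsCliqueTree G Set.univ T B) (hcf : ClawFree G) :
    Extendable T fun v => {b | v ∈ B b} := by
  intro u v huv
  by_contra! hcon
  obtain ⟨hedge, hleaf⟩ := hcon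
  set f : V → Set β := fun v => {b | v ∈ B b} with hf
  have hrep := hT.isSubtreeRep
  have hcu := hrep.connOn u
  obtain ⟨t, -, ht⟩ := Set.exists_of_ssubset huv
  obtain ⟨C, htC, hC⟩ := exists_isCompAvoiding (S := f u) (connOn_singleton (T := T) t)
    (by simpa using ht)
  have hCu : ∀ x ∈ C, x ∉ f u := fun x hx hxu => Set.disjoint_left.1 hC.disjoint hx hxu
  obtain ⟨s, hs⟩ := hcu.1
  -- an edge leaving `f u` leads to a vertex adjacent to `v` but not to `u`
  have hw : ∀ q r, T.Adj q r → q ∈ f u → r ∉ f u →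
      ∃ w, r ∈ f w ∧ Disjoint (f w) (f u) ∧ G.Adj v w := by
    intro q r hqr hq hr
    obtain ⟨w, hwr, hwq⟩ := Set.not_subset.1 (hT.not_subset r q hqr.symm)
    refine ⟨w, hwr, hT.cutAcyclic.disjoint_of_adj hqr hcu (hrep.connOn w) hq hr hwr hwq, ?_⟩
    refine (hrep.2 v w ?_).2 ⟨r, hedge q r hqr hq, hwr⟩
    rintro rfl
    exact hwq (huv.1 hq)
  obtain ⟨r₁, -, q₁, -, hr₁, hq₁, h₁⟩ := hT.connOn_univ.2 C t s trivial trivial (htC rfl)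
    fun h => hCu s h hs
  have hq₁u : q₁ ∈ f u := by_contra fun h => hq₁ (hC.mem_of_adj hr₁ h h₁)
  obtain ⟨w₁, hw₁r, hw₁u, hvw₁⟩ := hw q₁ r₁ h₁.symm hq₁u (hCu r₁ hr₁)
  by_cases hE : ∃ z, z ∉ C ∧ z ∉ f u
  · obtain ⟨z, hz⟩ := hE
    obtain ⟨r₂, -, q₂, -, hr₂, hq₂, h₂⟩ := hT.connOn_univ.2 {z | z ∉ C ∧ z ∉ f u} z s trivial
      trivial hz fun h => h.2 hs
    have hq₂C : q₂ ∉ C := fun h => hr₂.1 (hC.mem_of_adj h hr₂.2 h₂.symm)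
    have hq₂u : q₂ ∈ f u := by_contra fun h => hq₂ ⟨hq₂C, h⟩
    obtain ⟨w₂, hw₂r, hw₂u, hvw₂⟩ := hw q₂ r₂ h₂.symm hq₂u hr₂.2
    have hw₁C : f w₁ ⊆ C := hC.subset_of_meets _ (hrep.connOn w₁) hw₁u ⟨r₁, hw₁r, hr₁⟩
    have hw₂C : Disjoint (f w₂) C := by
      rw [Set.disjoint_left]
      exact fun x hx hxC =>
        hr₂.1 (hC.subset_of_meets _ (hrep.connOn w₂) hw₂u ⟨x, hx, hxC⟩ hw₂r)
    have hd : Disjoint (f w₁) (f w₂) := (hw₂C.mono_right hw₁C).symm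
    have hne : ∀ {x y : V}, Disjoint (f x) (f y) → x ≠ y := by
      rintro x y hxy rfl
      obtain ⟨b, hb⟩ := (hrep.connOn x).1
      exact Set.disjoint_left.1 hxy hb hb
    have hna : ∀ {x y : V}, Disjoint (f x) (f y) → ¬ G.Adj x y :=
      fun h => (hrep.disjoint_iff (hne h)).1 h
    have huv' : G.Adj v u := (hrep.2 v u (by rintro rfl; exact huv.ne rfl)).2 ⟨s, huv.1 hs, hs⟩
    exact hcf ⟨v, u, w₁, w₂, hne hw₁u.symm, hne hw₂u.symm, hne hd, huv', hvw₁, hvw₂,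
      hna hw₁u.symm, hna hw₂u.symm, hna hd⟩
  · push Not at hE
    obtain ⟨l, hl, hlC⟩ := exists_leaf_notMem hT.connOn_univ hT.cutAcyclic hC.connOn
      fun h => hCu s (h ▸ trivial) hs
    exact hleaf l hl (hE l hlC)

theorem mem_closedNbhd {a x : V} : x ∈ closedNbhd G a ↔ x = a ∨ G.Adj a x := Iff.rfl

theorem exists_attachment (hc : ConnOn G Set.univ) (a : V)
    (C : (G.induce (closedNbhd G a)ᶜ).ConnectedComponent) :
    ∃ x ∈ compBoundary G a C, x ≠ a := by
  obtain ⟨⟨c, hca⟩, rfl⟩ := C.exists_rep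
  obtain ⟨p, -, q, -, hp, hq, hpq⟩ := hc.2
    {z | ∃ h : z ∈ (closedNbhd G a)ᶜ, (G.induce (closedNbhd G a)ᶜ).connectedComponentMk ⟨z, h⟩ =
      (G.induce (closedNbhd G a)ᶜ).connectedComponentMk ⟨c, hca⟩} c a trivial trivial ⟨hca, rfl⟩
    fun h => h.1 (Or.inl rfl)
  obtain ⟨hpa, hpc⟩ := hp
  have hqa : q ∈ closedNbhd G a := by
    by_contra hqa
    refine hq ⟨hqa, ?_⟩
    rw [← hpc, ConnectedComponent.eq]
    exact Adj.reachable (G := G.induce (closedNbhd G a)ᶜ) (u := ⟨q, hqa⟩) (v := ⟨p, hpa⟩) hpq.symm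
  refine ⟨q, ⟨hqa, ⟨p, hpa⟩, hpc, hpq.symm⟩, ?_⟩
  rintro rfl
  exact hpa (Or.inr hpq.symm)

/-- In a claw-free graph, a neighbour of `a` attaches to at most one component of `G - N[a]`. -/
theorem ClawFree.component_eq (hcf : ClawFree G) {a x : V} (hxa : x ≠ a)
    {C₁ C₂ : (G.induce (closedNbhd G a)ᶜ).ConnectedComponent}
    (h₁ : x ∈ compBoundary G a C₁) (h₂ : x ∈ compBoundary G a C₂) : C₁ = C₂ := by
  obtain ⟨hx, ⟨y, hy⟩, rfl, hxy⟩ := h₁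
  obtain ⟨-, ⟨z, hz⟩, rfl, hxz⟩ := h₂
  by_contra hne
  have hya : a ≠ y ∧ ¬ G.Adj a y := ⟨fun h => hy (Or.inl h.symm), fun h => hy (Or.inr h)⟩
  have hza : a ≠ z ∧ ¬ G.Adj a z := ⟨fun h => hz (Or.inl h.symm), fun h => hz (Or.inr h)⟩
  refine hcf ⟨x, a, y, z, hya.1, hza.1, ?_, (hx.resolve_left hxa).symm, hxy, hxz, hya.2, hza.2, ?_⟩
  · rintro rfl
    exact hne rfl
  · intro hyz
    exact hne (ConnectedComponent.eq.2
      (Adj.reachable (G := G.induce (closedNbhd G a)ᶜ) (u := ⟨y, hy⟩) (v := ⟨z, hz⟩) hyz))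

theorem IsMEP.exists_walk_avoiding (hcf : ClawFree G) (hc : ConnOn G Set.univ) {a x y : V}
    (ha : IsMEP G a) (hx : x ∉ closedNbhd G a) (hy : y ∉ closedNbhd G a) :
    ∃ p : G.Walk x y, ∀ w ∈ p.support, w ≠ a ∧ ¬ G.Adj a w := by
  let H := G.induce (closedNbhd G a)ᶜ
  have heq : H.connectedComponentMk ⟨x, hx⟩ = H.connectedComponentMk ⟨y, hy⟩ := by
    obtain ⟨z, hz, hza⟩ := exists_attachment hc a (H.connectedComponentMk ⟨x, hx⟩)
    exact hcf.component_eq hza hz (ha.2 _ (H.connectedComponentMk ⟨y, hy⟩) ▸ hz)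
  obtain ⟨p⟩ := ConnectedComponent.eq.1 heq
  refine ⟨p.map (Embedding.induce (G := G) (closedNbhd G a)ᶜ).toHom, fun w hw => ?_⟩
  have hw' := (Walk.support_map (Embedding.induce (G := G) (closedNbhd G a)ᶜ).toHom p) ▸ hw
  obtain ⟨w', -, rfl⟩ := List.mem_map.1 hw'
  exact ⟨fun h => w'.2 (Or.inl h), fun h => w'.2 (Or.inr h)⟩

theorem IsSimplicial.closedNbhd_subset {a b : V} (ha : IsSimplicial G a) (hab : G.Adj a b) :
    closedNbhd G a ⊆ closedNbhd G b := by
  rintro x (rfl | hx)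
  · exact Or.inr hab.symm
  · by_cases hxb : x = b
    · exact Or.inl hxb
    · exact Or.inr (ha hab hx (Ne.symm hxb))

theorem exists_asteroidalSet_of_isMEP (hcf : ClawFree G) (hc : ConnOn G Set.univ) :
    ∃ A : Set V, AsteroidalSet G A ∧
      A.ncard = {N : Set V | ∃ a, IsMEP G a ∧ N = closedNbhd G a}.ncard := by
  have hchoice : ∀ N ∈ {N : Set V | ∃ a, IsMEP G a ∧ N = closedNbhd G a},
      ∃ a, IsMEP G a ∧ N = closedNbhd G a := fun N h => h
  obtain ⟨v, -⟩ := hc.1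
  have : Nonempty V := ⟨v⟩
  choose! r hr hrN using hchoice
  refine ⟨r '' {N : Set V | ∃ a, IsMEP G a ∧ N = closedNbhd G a}, ?_, ?_⟩
  · have hnot : ∀ N ∈ {N : Set V | ∃ a, IsMEP G a ∧ N = closedNbhd G a},
        ∀ M ∈ {N : Set V | ∃ a, IsMEP G a ∧ N = closedNbhd G a}, r N ≠ r M →
          r N ∉ closedNbhd G (r M) := by
      intro N hN M hM hne hmem
      have hadj := hmem.resolve_left hne
      apply hne
      congr 1
      rw [hrN N hN, hrN M hM]
      exact ((hr N hN).1.closedNbhd_subset hadj.symm).antisymm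
        ((hr M hM).1.closedNbhd_subset hadj)
    rintro _ ⟨X, hX, rfl⟩ _ ⟨Y, hY, rfl⟩ _ ⟨Z, hZ, rfl⟩ - hyz hxz
    exact (hr Z hZ).exists_walk_avoiding hcf hc (hnot X hX Z hZ hxz) (hnot Y hY Z hZ hyz)
  · refine Set.InjOn.ncard_image fun X hX Y hY hXY => ?_
    rw [hrN X hX, hrN Y hY, hXY]

theorem IsCliqueTree.exists_isMEP_of_isLeaf (hT : IsCliqueTree G Set.univ T B) (hcf : ClawFree G)
    (hc : ConnOn G Set.univ) {q : β} (hq : IsLeaf T q) :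
    ∃ a, IsMEP G a ∧ B q = closedNbhd G a ∧ ∀ b, a ∈ B b → b = q := by
  obtain ⟨r, hr⟩ := isLeaf_iff.1 hq
  have hqr : T.Adj q r := (hr r).2 rfl
  have hrep := hT.isSubtreeRep
  have hmeet : ∀ x, x ∈ B q → (∃ b, b ≠ q ∧ x ∈ B b) → x ∈ B r := by
    rintro x hx ⟨b, hbq, hb⟩
    obtain ⟨p, -, c, hc, rfl, -, hpc⟩ := (hrep.connOn x).2 {q} q b hx hb rfl hbq
    exact (hr c).1 hpc ▸ hc
  obtain ⟨a, haq, har⟩ := Set.not_subset.1 (hT.not_subset q r hqr)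
  have hab : ∀ b, a ∈ B b → b = q := fun b hb => by_contra fun hne => har (hmeet a haq ⟨b, hne, hb⟩)
  have hN : B q = closedNbhd G a := by
    ext x
    rw [mem_closedNbhd]
    by_cases hxa : x = a
    · simp [hxa, haq]
    rw [hrep.2 a x (Ne.symm hxa)]
    refine ⟨fun hx => Or.inr ⟨q, haq, hx⟩, ?_⟩
    rintro (h | ⟨b, hb, hxb⟩)
    · exact absurd h hxa
    · exact hab b hb ▸ hxb
  obtain ⟨w, hwr, hwq⟩ := Set.not_subset.1 (hT.not_subset r q hqr.symm)
  have hwa : w ∈ (closedNbhd G a)ᶜ := hN ▸ hwq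
  have hcomp : ∀ C : (G.induce (closedNbhd G a)ᶜ).ConnectedComponent,
      C = (G.induce (closedNbhd G a)ᶜ).connectedComponentMk ⟨w, hwa⟩ := by
    intro C
    obtain ⟨x, hx, hxa⟩ := exists_attachment hc a C
    refine hcf.component_eq hxa hx ?_
    obtain ⟨hxN, ⟨h, hh⟩, -, hxh⟩ := hx
    refine ⟨hxN, ⟨w, hwa⟩, rfl, ?_⟩
    obtain ⟨b, hxb, hhb⟩ := (hrep.2 x h hxh.ne).1 hxh
    have hxr : x ∈ B r := by
      refine hmeet x (hN ▸ hxN) ⟨b, ?_, hxb⟩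
      rintro rfl
      exact hh (hN ▸ hhb)
    exact (hrep.2 x w (by rintro rfl; exact hwa hxN)).2 ⟨r, hxr, hwr⟩
  refine ⟨a, ⟨fun x hx y hy hxy => ?_, fun C₁ C₂ => by rw [hcomp C₁, hcomp C₂]⟩, hN, hab⟩
  exact hT.isClique q (hN ▸ Or.inr hx) (hN ▸ Or.inr hy) hxy

theorem IsCliqueTree.numLeaves_le [Finite V] (hT : IsCliqueTree G Set.univ T B) (hcf : ClawFree G)
    (hc : ConnOn G Set.univ) :
    numLeaves T ≤ {N : Set V | ∃ a, IsMEP G a ∧ N = closedNbhd G a}.ncard := by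
  refine Set.ncard_le_ncard_of_injOn B (fun q hq => ?_) (fun q hq p hp hqp => ?_) (Set.toFinite _)
  · obtain ⟨a, ha, hN, -⟩ := hT.exists_isMEP_of_isLeaf hcf hc hq
    exact ⟨a, ha, hN⟩
  · obtain ⟨a, -, hN, ha⟩ := hT.exists_isMEP_of_isLeaf hcf hc hq
    exact (ha p (hqp ▸ hN ▸ Or.inl rfl)).symm

end CliqueTree

section ProperRepresentation

variable {V : Type*} {G : SimpleGraph V} {β : Type*} {T : SimpleGraph β} {f : V → Set β}
  {P : V → Prop}

theorem IsSubtreeRep.optionExtend {T' : SimpleGraph (Option β)} {q : β} (h : IsSubtreeRep G T f)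
    (hP : ∀ w, P w → q ∈ f w) (hconn : ∀ w, ConnOn T' (optionExtend (f w) (P w))) :
    IsSubtreeRep G T' fun w => optionExtend (f w) (P w) := by
  refine ⟨fun w => isSubtree_iff_connOn.2 (hconn w), fun x y hxy => ?_⟩
  rw [optionExtend_inter_nonempty_iff, h.2 x y hxy]
  exact ⟨Or.inl, fun h' => h'.elim id fun h' => ⟨q, hP x h'.1, hP y h'.2⟩⟩

theorem ssubset_of_optionExtend_ssubset (hP : ∀ w w', f w = f w' → P w → P w') {x y : V}
    (h : optionExtend (f x) (P x) ⊂ optionExtend (f y) (P y)) :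
    f x ⊂ f y ∧ (P x → P y) := by
  rw [ssubset_iff_subset_not_subset, optionExtend_subset_iff, optionExtend_subset_iff] at h
  refine ⟨⟨h.1.1, fun hyx => h.2 ⟨hyx, hP y x (hyx.antisymm h.1.1)⟩⟩, h.1.2⟩

/-- A strict containment `f u ⊂ f v` with `f u` minimal is destroyed by adding one vertex to the
host tree, without creating new containments. -/
theorem Extendable.exists_extension [Finite β] (hext : Extendable T f) (hT : ConnOn T Set.univ)
    (hac : CutAcyclic T) (h : IsSubtreeRep G T f) {u v : V} (huv : f u ⊂ f v)
    (hmin : ∀ x, ¬ f x ⊂ f u) :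
    ∃ (T' : SimpleGraph (Option β)) (f' : V → Set (Option β)), ConnOn T' Set.univ ∧
      CutAcyclic T' ∧ IsSubtreeRep G T' f' ∧ Extendable T' f' ∧ numLeaves T' ≤ numLeaves T ∧
      ¬ f' u ⊂ f' v ∧ ∀ x y, f' x ⊂ f' y → f x ⊂ f y := by
  rcases hext u v huv with ⟨q, r, hqr, hqu, hrv⟩ | ⟨t, ht, htu⟩
  · have hPq : ∀ w, (q ∈ f w ∧ r ∈ f w) ∨ f w = f u → q ∈ f w := by
      rintro w (hw | hw)
      exacts [hw.1, hw ▸ hqu]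
    have hPf : ∀ w w', f w = f w' → (q ∈ f w ∧ r ∈ f w) ∨ f w = f u →
        (q ∈ f w' ∧ r ∈ f w') ∨ f w' = f u := fun w w' hw => by rw [hw]; exact id
    refine ⟨subdivide T q r, fun w => optionExtend (f w) ((q ∈ f w ∧ r ∈ f w) ∨ f w = f u),
      hT.subdivide_univ, hac.subdivide hqr,
      h.optionExtend hPq fun w => (h.connOn w).subdivide (hPq w) fun h1 h2 => Or.inl ⟨h1, h2⟩,
      fun x y hxy => ?_, numLeaves_subdivide_le hqr, fun hlt => ?_,
      fun x y hxy => (ssubset_of_optionExtend_ssubset hPf hxy).1⟩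
    · have hfxy := (ssubset_of_optionExtend_ssubset hPf hxy).1
      have hyu : f y ≠ f u := fun hyu => hmin x (hyu ▸ hfxy)
      rcases hext x y hfxy with ⟨a, b, hab, ha, hb⟩ | ⟨t, ht, htx⟩
      · left
        by_cases h1 : a = q ∧ b = r
        · obtain ⟨rfl, rfl⟩ := h1
          exact ⟨some a, none, Or.inl rfl, ha, fun hn => hn.elim (fun hn => hb hn.2) hyu⟩
        by_cases h2 : a = r ∧ b = q
        · obtain ⟨rfl, rfl⟩ := h2
          exact ⟨some a, none, Or.inr rfl, ha, fun hn => hn.elim (fun hn => hb hn.1) hyu⟩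
        exact ⟨some a, some b, ⟨hab, h1, h2⟩, ha, hb⟩
      · exact Or.inr ⟨some t, (isLeaf_subdivide_some_iff hqr).2 ht, htx⟩
    · exact ((ssubset_of_optionExtend_ssubset hPf hlt).2 (Or.inr rfl)).elim (fun hn => hrv hn.2)
        huv.ne'
  · have hPt : ∀ w, f w = f u → t ∈ f w := fun w hw => hw ▸ htu
    have hPf : ∀ w w', f w = f w' → f w = f u → f w' = f u := fun w w' hw hwu => hw ▸ hwu
    refine ⟨attach T t, fun w => optionExtend (f w) (f w = f u),
      hT.attach_univ, hac.attach, h.optionExtend hPt fun w => (h.connOn w).attach (hPt w),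
      fun x y hxy => ?_, numLeaves_attach_le ht, fun hlt => ?_,
      fun x y hxy => (ssubset_of_optionExtend_ssubset hPf hxy).1⟩
    · have hfxy := (ssubset_of_optionExtend_ssubset hPf hxy).1
      have hyu : f y ≠ f u := fun hyu => hmin x (hyu ▸ hfxy)
      rcases hext x y hfxy with ⟨a, b, hab, ha, hb⟩ | ⟨s, hs, hsx⟩
      · exact Or.inl ⟨some a, some b, hab, ha, hb⟩
      · by_cases hst : s = t
        · subst hst
          exact Or.inl ⟨some s, none, rfl, hsx, hyu⟩
        · exact Or.inr ⟨some s, (isLeaf_attach_some_iff hst).2 hs, hsx⟩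
    · exact huv.ne' ((ssubset_of_optionExtend_ssubset hPf hlt).2 rfl)

theorem Extendable.exists_isProperSubtreeRep [Finite V] (n : ℕ) :
    ∀ {β : Type} [Finite β] {T : SimpleGraph β} {f : V → Set β}, Extendable T f →
      ConnOn T Set.univ → CutAcyclic T → IsSubtreeRep G T f →
      {p : V × V | f p.1 ⊂ f p.2}.ncard = n →
      ∃ (β' : Type) (_ : Finite β') (T' : SimpleGraph β') (f' : V → Set β'), T'.IsTree ∧
        IsProperSubtreeRep G T' f' ∧ numLeaves T' ≤ numLeaves T := by
  induction n using Nat.strong_induction_on with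
  | _ n ih =>
    intro β _ T f hext hT hac h hn
    by_cases hbad : ∃ u v, f u ⊂ f v
    · obtain ⟨u, ⟨v, huv⟩, hu⟩ := exists_minimalFor_of_wellFoundedLT (fun u => ∃ v, f u ⊂ f v) f hbad
      obtain ⟨T', f', hT', hac', h', hext', hle, huv', hsub⟩ := hext.exists_extension hT hac h huv
        fun x hx => hx.not_subset (hu ⟨u, hx⟩ hx.subset)
      have hlt : {p : V × V | f' p.1 ⊂ f' p.2}.ncard < n := by
        rw [← hn]
        refine Set.ncard_lt_ncard ⟨fun p hp => hsub _ _ hp, fun hss => huv' ?_⟩ (Set.toFinite _)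
        exact hss (a := (u, v)) huv
      obtain ⟨β', hβ', T'', f'', ht, hp, hle'⟩ := ih _ hlt hext' hT' hac' h' rfl
      exact ⟨β', hβ', T'', f'', ht, hp, hle'.trans hle⟩
    · exact ⟨β, inferInstance, T, f, isTree_iff_cuts.2 ⟨hT, hac⟩,
        ⟨h, fun u v _ huv => hbad ⟨u, v, huv⟩⟩, le_rfl⟩

theorem numLeaves_map_equiv {γ : Type*} (e : β ≃ γ) :
    numLeaves (T.map e.toEmbedding) = numLeaves T := by
  have hleaf : ∀ x, IsLeaf (T.map e.toEmbedding) (e x) ↔ IsLeaf T x := by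
    intro x
    have hnbr : (T.map e.toEmbedding).neighborSet (e x) = e '' T.neighborSet x := by
      ext y
      obtain ⟨y, rfl⟩ := e.surjective y
      rw [e.injective.mem_set_image]
      exact T.map_adj_apply (f := e.toEmbedding)
    rw [IsLeaf, IsLeaf, hnbr, Set.ncard_image_of_injective _ e.injective]
  have : {x | IsLeaf (T.map e.toEmbedding) x} = e '' {x | IsLeaf T x} := by
    ext y
    rw [Set.mem_image_equiv]
    simp [← hleaf]
  rw [numLeaves, this, Set.ncard_image_of_injective _ e.injective, numLeaves]

/-- A proper subtree representation in a finite host tree is one in a host tree on `Fin m`. -/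
theorem IsProperSubtreeRep.exists_fin [Finite β] (hT : T.IsTree)
    (h : IsProperSubtreeRep G T f) : ∃ (m : ℕ) (T' : SimpleGraph (Fin m)) (f' : V → Set (Fin m)),
      T'.IsTree ∧ IsProperSubtreeRep G T' f' ∧ numLeaves T' = numLeaves T := by
  obtain ⟨e⟩ : Nonempty (β ≃ Fin (Nat.card β)) := ⟨Finite.equivFin β⟩
  refine ⟨_, T.map e.toEmbedding, fun v => e '' f v,
    (Iso.map e T).isTree_iff.1 hT, ⟨⟨fun v => ?_, fun u v huv => ?_⟩, fun u v huv => ?_⟩,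
    numLeaves_map_equiv e⟩
  · exact ((Iso.map e T).induce e.injective.injOn.bijOn_image).connected_iff.1 (h.1.1 v)
  · rw [h.1.2 u v huv, ← Set.image_inter e.injective, Set.image_nonempty]
  · exact fun hlt => h.2 u v huv ⟨(Set.image_subset_image_iff e.injective).1 hlt.1,
      fun h' => hlt.2 (Set.image_mono h')⟩

end ProperRepresentation

end Leafage

theorem stmt19 {V : Type*} [Fintype V] (G : SimpleGraph V) (hG : IsChordal G)
    (hc : G.Connected) (hnc : G ≠ ⊤) (hcf : ClawFree G) :
    leafage G = properLeafage G ∧ properLeafage G = astNum G ∧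
    astNum G = {N : Set V | ∃ a, IsMEP G a ∧ N = closedNbhd G a}.ncard := by
  have hconn := connected_iff_connOn_univ.1 hc
  set N := {N : Set V | ∃ a, IsMEP G a ∧ N = closedNbhd G a}.ncard
  have hN : N ≤ astNum G := by
    refine le_csSup ⟨Nat.card V, ?_⟩ (exists_asteroidalSet_of_isMEP hcf hconn)
    rintro _ ⟨A, -, rfl⟩
    exact Set.ncard_le_card A
  obtain ⟨β, _, T, B, hB⟩ := hG.exists_isCliqueTree _ Set.univ rfl
  obtain ⟨β', _, T', f', hT', hf', hle⟩ := (hB.extendable hcf).exists_isProperSubtreeRep _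
    hB.connOn_univ hB.cutAcyclic hB.isSubtreeRep rfl
  have hproper : properLeafage G ≤ N :=
    (Nat.sInf_le (hf'.exists_fin hT')).trans (hle.trans (hB.numLeaves_le hcf hconn))
  have hne : {L | ∃ (m : ℕ) (T : SimpleGraph (Fin m)) (f : V → Set (Fin m)),
      T.IsTree ∧ IsProperSubtreeRep G T f ∧ numLeaves T = L}.Nonempty := ⟨_, hf'.exists_fin hT'⟩
  obtain ⟨m, S, g, hS, hg, hSL⟩ := Nat.sInf_mem hne
  have hleaf : leafage G ≤ properLeafage G := Nat.sInf_le ⟨m, S, g, hS, hg.1, hSL⟩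
  obtain ⟨m, S, g, hS, hg, hSL⟩ := Nat.sInf_mem (⟨_, m, S, g, hS, hg.1, hSL⟩ :
    {L | ∃ (m : ℕ) (T : SimpleGraph (Fin m)) (f : V → Set (Fin m)),
      T.IsTree ∧ IsSubtreeRep G T f ∧ numLeaves T = L}.Nonempty)
  have hast : astNum G ≤ leafage G := by
    refine csSup_le ⟨_, _, (exists_asteroidalSet_of_isMEP hcf hconn).choose_spec.1, rfl⟩ ?_
    rintro _ ⟨A, hA, rfl⟩
    obtain ⟨hS, hac⟩ := isTree_iff_cuts.1 hS
    exact (ncard_le_numLeaves_of_asteroidalSet hS hac hg hnc hA).trans_eq hSL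
  omega
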